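/- arXiv:1911.00251 — 3 statements merged into one kernel-verified Lean document; each statement's English description precedes it below -/
import Mathlib

section
/- Let E be a real Hilbert space and f : E → ℝ a convex function that is differentiable everywhere with gradient ∇f, and suppose ∇f is β-Lipschitz for some β > 0, i.e. ‖∇f(x) − ∇f(y)‖ ≤ β‖x − y‖ for all x, y. Let w* be a global minimizer of f, let η > 0 satisfy 1 − βη/2 > 0, and define the gradient-descent iterates w^{t+1} = w^t − η ∇f(w^t) from an arbitrary initial point w^0. Then for every integer t ≥ 1, f(w^t) − f(w*) ≤ ‖w^0 − w*‖² · 1/(η(1 − βη/2)) · (1/t). In particular gradient descent converges at rate O(1/t). -/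
open AffineMap in
theorem HasGradientAt.hasDerivAt_comp_lineMap {E : Type*} [NormedAddCommGroup E]
    [InnerProductSpace ℝ E] [CompleteSpace E] {f : E → ℝ} {g x y : E} {s : ℝ}
    (h : HasGradientAt f g (lineMap x y s)) :
    HasDerivAt (fun r : ℝ => f (lineMap x y r)) (inner ℝ g (y - x)) s := by
  simpa [Function.comp_def] using h.hasFDerivAt.comp_hasDerivAt s hasDerivAt_lineMap

theorem ConvexOn.add_inner_le_of_hasGradientAt {E : Type*} [NormedAddCommGroup E]
    [InnerProductSpace ℝ E] [CompleteSpace E] {f : E → ℝ} {g x : E}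
    (hf : ConvexOn ℝ Set.univ f) (h : HasGradientAt f g x) (y : E) :
    f x + inner ℝ g (y - x) ≤ f y := by
  have hc : ConvexOn ℝ Set.univ (fun r : ℝ => f (AffineMap.lineMap x y r)) :=
    hf.comp_affineMap (AffineMap.lineMap x y)
  have hd : HasDerivAt (fun r : ℝ => f (AffineMap.lineMap x y r)) (inner ℝ g (y - x)) 0 :=
    HasGradientAt.hasDerivAt_comp_lineMap (by simpa using h)
  have := hc.le_slope_of_hasDerivAt (Set.mem_univ 0) (Set.mem_univ 1) one_pos hd
  simp [slope_def_field] at this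
  linarith

/-- The descent lemma: a function with `β`-Lipschitz gradient lies below its quadratic model. -/
theorem le_add_inner_add_of_lipschitz_gradient {E : Type*} [NormedAddCommGroup E]
    [InnerProductSpace ℝ E] [CompleteSpace E] {f : E → ℝ} {f' : E → E} {β : ℝ}
    (hgrad : ∀ x, HasGradientAt f (f' x) x)
    (hlip : ∀ x y, ‖f' x - f' y‖ ≤ β * ‖x - y‖) (x y : E) :
    f y ≤ f x + inner ℝ (f' x) (y - x) + β / 2 * ‖y - x‖ ^ 2 := by
  have hd : ∀ s : ℝ, HasDerivAt (fun r : ℝ => f (AffineMap.lineMap x y r)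
      - r * inner ℝ (f' x) (y - x) - r ^ 2 * (β / 2 * ‖y - x‖ ^ 2))
      (inner ℝ (f' (AffineMap.lineMap x y s)) (y - x) - inner ℝ (f' x) (y - x)
        - 2 * s * (β / 2 * ‖y - x‖ ^ 2)) s := fun s => by
    have h := ((hgrad (AffineMap.lineMap x y s)).hasDerivAt_comp_lineMap.fun_sub
      ((hasDerivAt_id s).mul_const (inner ℝ (f' x) (y - x)))).fun_sub
      ((hasDerivAt_pow 2 s).mul_const (β / 2 * ‖y - x‖ ^ 2))
    simpa using h
  have hanti := antitoneOn_of_deriv_nonpos (convex_Icc (0 : ℝ) 1)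
    (fun s _ => (hd s).continuousAt.continuousWithinAt)
    (fun s _ => (hd s).differentiableAt.differentiableWithinAt)
    (fun s hs => by
      rw [interior_Icc] at hs
      rw [(hd s).deriv, ← inner_sub_left]
      have h1 := real_inner_le_norm (f' (AffineMap.lineMap x y s) - f' x) (y - x)
      have h2 := hlip (AffineMap.lineMap x y s) x
      have h3 : ‖(AffineMap.lineMap x y s : E) - x‖ = s * ‖y - x‖ := by
        simp [AffineMap.lineMap_apply, norm_smul, abs_of_pos hs.1]
      rw [h3] at h2
      have h4 := mul_le_mul_of_nonneg_right h2 (norm_nonneg (y - x))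
      linarith)
  have := hanti (Set.left_mem_Icc.2 zero_le_one) (Set.right_mem_Icc.2 zero_le_one) zero_le_one
  simp at this
  linarith

theorem HasGradientAt.eq_zero_of_forall_le {E : Type*} [NormedAddCommGroup E]
    [InnerProductSpace ℝ E] [CompleteSpace E] {f : E → ℝ} {g x : E}
    (h : HasGradientAt f g x) (hmin : ∀ y, f x ≤ f y) : g = 0 := by
  have hl : IsLocalMin f x := Filter.Eventually.of_forall hmin
  simpa using hl.hasFDerivAt_eq_zero h.hasFDerivAt

/-- Co-coercivity of a `β`-Lipschitz gradient of a convex function, relative to a minimizer. -/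
theorem ConvexOn.norm_gradient_sq_le_mul_inner {E : Type*} [NormedAddCommGroup E]
    [InnerProductSpace ℝ E] [CompleteSpace E] {f : E → ℝ} {f' : E → E} {β : ℝ} (hβ : 0 < β)
    (hconv : ConvexOn ℝ Set.univ f) (hgrad : ∀ x, HasGradientAt f (f' x) x)
    (hlip : ∀ x y, ‖f' x - f' y‖ ≤ β * ‖x - y‖)
    {z : E} (hmin : ∀ x, f z ≤ f x) (x : E) :
    ‖f' x‖ ^ 2 ≤ β * inner ℝ (f' x) (x - z) := by
  have h1 := le_add_inner_add_of_lipschitz_gradient hgrad hlip z (z + β⁻¹ • f' x)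
  have h2 := hconv.add_inner_le_of_hasGradientAt (hgrad x) (z + β⁻¹ • f' x)
  have h3 := le_add_inner_add_of_lipschitz_gradient hgrad hlip x (x - β⁻¹ • f' x)
  have h4 := hmin (x - β⁻¹ • f' x)
  have e : z + β⁻¹ • f' x - x = β⁻¹ • f' x - (x - z) := by abel
  have e' : x - β⁻¹ • f' x - x = -(β⁻¹ • f' x) := by abel
  rw [(hgrad z).eq_zero_of_forall_le hmin, add_sub_cancel_left, inner_zero_left, norm_smul,
    mul_pow, Real.norm_eq_abs, sq_abs] at h1
  rw [e, inner_sub_right, real_inner_smul_right, real_inner_self_eq_norm_sq] at h2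
  rw [e', inner_neg_right, real_inner_smul_right, real_inner_self_eq_norm_sq, norm_neg, norm_smul,
    mul_pow, Real.norm_eq_abs, sq_abs] at h3
  have e2 : β / 2 * (β⁻¹ ^ 2 * ‖f' x‖ ^ 2) = β⁻¹ * ‖f' x‖ ^ 2 / 2 := by field_simp
  rw [e2] at h1 h3
  have h5 : β⁻¹ * ‖f' x‖ ^ 2 ≤ inner ℝ (f' x) (x - z) := by linarith
  rwa [inv_mul_le_iff₀ hβ] at h5

theorem add_one_mul_le_of_le_sub_sq {x x' : ℝ} {t : ℕ} (hx : 0 ≤ x) (h : t * x ≤ 1)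
    (hx' : x' ≤ x - x ^ 2) : ((t : ℝ) + 1) * x' ≤ 1 := by
  have ht : (0 : ℝ) ≤ t := Nat.cast_nonneg t
  rcases le_total x 1 with h1 | h1
  · nlinarith [mul_le_mul_of_nonneg_right h (sub_nonneg.2 h1),
      mul_le_mul_of_nonneg_left hx' (by linarith : (0 : ℝ) ≤ t + 1), sq_nonneg x]
  · have : x' ≤ 0 := by nlinarith
    nlinarith

/-- Lemma 3: gradient descent on a convex β-smooth function converges at rate O(1/t). -/
theorem stmt_1 {E : Type*} [NormedAddCommGroup E] [InnerProductSpace ℝ E] [CompleteSpace E]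
    (f : E → ℝ) (f' : E → E) (β : ℝ) (hβ : 0 < β)
    (hconv : ConvexOn ℝ Set.univ f)
    (hgrad : ∀ x, HasGradientAt f (f' x) x)
    (hlip : ∀ x y, ‖f' x - f' y‖ ≤ β * ‖x - y‖)
    (wstar : E) (hmin : ∀ x, f wstar ≤ f x)
    (η : ℝ) (hη : 0 < η) (hstep : 0 < 1 - β * η / 2)
    (w : ℕ → E) (hiter : ∀ t, w (t + 1) = w t - η • f' (w t)) :
    ∀ t : ℕ, 1 ≤ t →
      f (w t) - f wstar ≤ ‖w 0 - wstar‖ ^ 2 * (1 / (η * (1 - β * η / 2))) * (1 / (t : ℝ)) := by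
  have hdesc : ∀ t, f (w (t + 1)) ≤ f (w t) - η * (1 - β * η / 2) * ‖f' (w t)‖ ^ 2 := fun t => by
    have h := le_add_inner_add_of_lipschitz_gradient hgrad hlip (w t) (w (t + 1))
    have e : w t - η • f' (w t) - w t = -(η • f' (w t)) := by abel
    rw [hiter, e, inner_neg_right, real_inner_smul_right, real_inner_self_eq_norm_sq, norm_neg,
      norm_smul, mul_pow, Real.norm_eq_abs, sq_abs, ← hiter] at h
    linarith
  have hdist : ∀ t, ‖w t - wstar‖ ^ 2 ≤ ‖w 0 - wstar‖ ^ 2 := fun t => by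
    induction t with
    | zero => exact le_rfl
    | succ t ih =>
      refine le_trans ?_ ih
      have e : w (t + 1) - wstar = (w t - wstar) - η • f' (w t) := by rw [hiter]; abel
      rw [e, norm_sub_sq_real, real_inner_smul_right, norm_smul, mul_pow, Real.norm_eq_abs, sq_abs,
        real_inner_comm]
      have hc := hconv.norm_gradient_sq_le_mul_inner hβ hgrad hlip hmin (w t)
      have hi : 0 ≤ inner ℝ (f' (w t)) (w t - wstar) :=
        nonneg_of_mul_nonneg_right (le_trans (sq_nonneg _) hc) hβ
      nlinarith [mul_le_mul_of_nonneg_left hc (sq_nonneg η),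
        mul_nonneg (mul_nonneg hη.le hstep.le) hi]
  have hsq : ∀ t, (f (w t) - f wstar) ^ 2 ≤ ‖f' (w t)‖ ^ 2 * ‖w 0 - wstar‖ ^ 2 := fun t => by
    have h1 := hconv.add_inner_le_of_hasGradientAt (hgrad (w t)) wstar
    rw [← neg_sub (w t) wstar, inner_neg_right] at h1
    have h2 := real_inner_le_norm (f' (w t)) (w t - wstar)
    calc (f (w t) - f wstar) ^ 2 ≤ (‖f' (w t)‖ * ‖w t - wstar‖) ^ 2 :=
          pow_le_pow_left₀ (sub_nonneg.2 (hmin _)) (by linarith) 2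
      _ = ‖f' (w t)‖ ^ 2 * ‖w t - wstar‖ ^ 2 := mul_pow _ _ _
      _ ≤ _ := mul_le_mul_of_nonneg_left (hdist t) (sq_nonneg _)
  have ha : 0 < η * (1 - β * η / 2) := mul_pos hη hstep
  set a := η * (1 - β * η / 2)
  set D := ‖w 0 - wstar‖ ^ 2
  intro t ht
  have ht' : (0 : ℝ) < t := by exact_mod_cast ht
  have hD₀ : 0 ≤ D := sq_nonneg _
  rcases hD₀.eq_or_lt with hD | hD
  · have h := hsq t
    rw [← hD, mul_zero] at h
    rw [← hD, pow_eq_zero_iff two_ne_zero |>.1 (le_antisymm h (sq_nonneg _))]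
    simp
  · have key : ∀ t : ℕ, (t : ℝ) * (a * (f (w t) - f wstar) / D) ≤ 1 := fun t => by
      induction t with
      | zero => simp
      | succ t ih =>
        push_cast
        refine add_one_mul_le_of_le_sub_sq
          (div_nonneg (mul_nonneg ha.le (sub_nonneg.2 (hmin _))) hD.le) ih ?_
        have e : a * (f (w t) - f wstar) / D - (a * (f (w t) - f wstar) / D) ^ 2
            = a * ((f (w t) - f wstar) - a * ((f (w t) - f wstar) ^ 2 / D)) / D := by
          ring
        rw [e]
        have h1 : (f (w t) - f wstar) ^ 2 / D ≤ ‖f' (w t)‖ ^ 2 := (div_le_iff₀ hD).2 (hsq t)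
        have h2 := mul_le_mul_of_nonneg_left h1 ha.le
        have h3 := hdesc t
        exact div_le_div_of_nonneg_right (mul_le_mul_of_nonneg_left (by linarith) ha.le) hD.le
    have h := key t
    rw [← mul_div_assoc, div_le_one hD] at h
    rw [mul_one_div, mul_one_div, div_div, le_div_iff₀ (mul_pos ha ht')]
    linarith
end

section
/- Let E be a real Hilbert space, let F : E → ℝ be convex, differentiable everywhere, with β-Lipschitz gradient for some β > 0, and let σ_e² ≥ 0. Suppose F^e : E → ℝ is differentiable everywhere and its gradient satisfies ∇F^e(w) = (1 + σ_e²) ∇F(w) for every w ∈ E. Let w* be a global minimizer of F, let η > 0 satisfy 1 − (1 + σ_e²)βη/2 > 0, and define the iterates w^{t+1} = w^t − η ∇F^e(w^t) from an arbitrary initial point w^0. Then w* is also a global minimizer of F^e, and for every integer t ≥ 1, F^e(w^t) − F^e(w*) ≤ ‖w^0 − w*‖² · 1/(η(1 − (1 + σ_e²)βη/2)) · (1/t). -/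
open scoped RealInnerProductSpace in
/-- The chain rule for a function with a gradient, along a line. -/
theorem HasGradientAt.hasDerivAt_line {E : Type*} [NormedAddCommGroup E] [InnerProductSpace ℝ E]
    [CompleteSpace E] {f : E → ℝ} {g x v : E} {s : ℝ} (h : HasGradientAt f g (x + s • v)) :
    HasDerivAt (fun r : ℝ => f (x + r • v)) ⟪g, v⟫ s := by
  have hline : HasDerivAt (fun r : ℝ => x + r • v) v s := by
    simpa using ((hasDerivAt_id s).smul_const v).const_add x
  simpa [Function.comp_def] using h.hasFDerivAt.comp_hasDerivAt s hline

open scoped RealInnerProductSpace in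
/-- First-order characterization of convexity: the graph lies above its tangent hyperplanes. -/
theorem ConvexOn.add_inner_gradient_le {E : Type*} [NormedAddCommGroup E] [InnerProductSpace ℝ E]
    [CompleteSpace E] {f : E → ℝ} {g x : E} (hf : ConvexOn ℝ Set.univ f)
    (h : HasGradientAt f g x) (y : E) : f x + ⟪g, y - x⟫ ≤ f y := by
  have hconv : ConvexOn ℝ Set.univ (fun r : ℝ => f (x + r • (y - x))) := by
    simpa [Function.comp_def, AffineMap.lineMap_apply_module', add_comm] using
      hf.comp_affineMap (AffineMap.lineMap x y : ℝ →ᵃ[ℝ] E)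
  have hderiv : HasDerivAt (fun r : ℝ => f (x + r • (y - x))) ⟪g, y - x⟫ 0 :=
    HasGradientAt.hasDerivAt_line (by simpa using h)
  have := hconv.le_slope_of_hasDerivAt (Set.mem_univ 0) (Set.mem_univ 1) one_pos hderiv
  simp only [slope_def_field, one_smul, zero_smul, add_zero, add_sub_cancel, sub_zero,
    div_one] at this
  linarith

open scoped RealInnerProductSpace in
/-- The quadratic upper bound for a function with `L`-Lipschitz gradient. -/
theorem le_add_inner_gradient_add_sq {E : Type*} [NormedAddCommGroup E] [InnerProductSpace ℝ E]
    [CompleteSpace E] {f : E → ℝ} {g : E → E} {L : ℝ} (h : ∀ x, HasGradientAt f (g x) x)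
    (hlip : ∀ x y, ‖g x - g y‖ ≤ L * ‖x - y‖) (x y : E) :
    f y ≤ f x + ⟪g x, y - x⟫ + L / 2 * ‖y - x‖ ^ 2 := by
  set v := y - x
  have hderiv (s : ℝ) : HasDerivAt
      (fun r : ℝ => f (x + r • v) - (r * ⟪g x, v⟫ + L / 2 * ‖v‖ ^ 2 * r ^ 2))
      (⟪g (x + s • v), v⟫ - (⟪g x, v⟫ + L * ‖v‖ ^ 2 * s)) s := by
    refine ((h (x + s • v)).hasDerivAt_line.sub
      (((hasDerivAt_id s).mul_const ⟪g x, v⟫).add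
        ((hasDerivAt_pow 2 s).const_mul (L / 2 * ‖v‖ ^ 2)))).congr_deriv ?_
    norm_num
    ring
  have hanti := antitoneOn_of_deriv_nonpos (convex_Icc (0 : ℝ) 1)
    (fun s _ => (hderiv s).continuousAt.continuousWithinAt)
    (fun s _ => (hderiv s).differentiableAt.differentiableWithinAt) (fun s hs => by
      rw [interior_Icc] at hs
      have hinner : ⟪g (x + s • v) - g x, v⟫ ≤ L * (s * ‖v‖) * ‖v‖ := by
        refine (real_inner_le_norm _ _).trans ?_
        gcongr
        simpa [norm_smul, abs_of_pos hs.1] using hlip (x + s • v) x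
      rw [inner_sub_left] at hinner
      rw [(hderiv s).deriv]
      linarith)
  have := hanti (Set.left_mem_Icc.2 zero_le_one) (Set.right_mem_Icc.2 zero_le_one) zero_le_one
  have hend : x + v = y := add_sub_cancel x y
  simp only [one_smul, zero_smul, hend, add_zero] at this
  linarith

/-- A gradient step of size `η` decreases an `L`-smooth function. -/
theorem gradient_step_le {E : Type*} [NormedAddCommGroup E] [InnerProductSpace ℝ E]
    [CompleteSpace E] {f : E → ℝ} {g : E → E} {L : ℝ} (h : ∀ x, HasGradientAt f (g x) x)
    (hlip : ∀ x y, ‖g x - g y‖ ≤ L * ‖x - y‖) (η : ℝ) (x : E) :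
    f (x - η • g x) ≤ f x - η * (1 - L * η / 2) * ‖g x‖ ^ 2 := by
  have := le_add_inner_gradient_add_sq h hlip x (x - η • g x)
  rw [sub_sub_cancel_left, inner_neg_right, real_inner_smul_right, real_inner_self_eq_norm_sq,
    norm_neg, norm_smul, mul_pow, Real.norm_eq_abs, sq_abs] at this
  linarith

open scoped RealInnerProductSpace in
/-- Cocoercivity of the gradient of a smooth convex function, relative to a minimizer. -/
theorem norm_sq_gradient_le_mul_inner {E : Type*} [NormedAddCommGroup E] [InnerProductSpace ℝ E]
    [CompleteSpace E] {f : E → ℝ} {g : E → E} {L : ℝ} (hL : 0 < L)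
    (hf : ConvexOn ℝ Set.univ f) (h : ∀ x, HasGradientAt f (g x) x)
    (hlip : ∀ x y, ‖g x - g y‖ ≤ L * ‖x - y‖) {z : E} (hz : ∀ x, f z ≤ f x) (x : E) :
    ‖g x‖ ^ 2 ≤ L * ⟪g x, x - z⟫ := by
  have hgz : g z = 0 := by
    have := IsLocalMin.hasFDerivAt_eq_zero (Filter.Eventually.of_forall hz) (h z).hasFDerivAt
    simpa using this
  have hupper := le_add_inner_gradient_add_sq h hlip z (z + L⁻¹ • g x)
  have hlower := hf.add_inner_gradient_le (h x) (z + L⁻¹ • g x)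
  have hdecrease := (hz _).trans (gradient_step_le h hlip L⁻¹ x)
  rw [hgz, inner_zero_left, add_sub_cancel_left, norm_smul, mul_pow, Real.norm_eq_abs,
    sq_abs] at hupper
  rw [add_sub_right_comm, inner_add_right, real_inner_smul_right,
    real_inner_self_eq_norm_sq, ← neg_sub x z, inner_neg_right] at hlower
  have key : L⁻¹ * ‖g x‖ ^ 2 ≤ ⟪g x, x - z⟫ := by
    have e1 : L / 2 * (L⁻¹ ^ 2 * ‖g x‖ ^ 2) = L⁻¹ * ‖g x‖ ^ 2 / 2 := by field_simp
    have e2 : L⁻¹ * (1 - L * L⁻¹ / 2) * ‖g x‖ ^ 2 = L⁻¹ * ‖g x‖ ^ 2 / 2 := by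
      field_simp
      ring
    linarith
  rwa [inv_mul_le_iff₀ hL] at key

/-- Gradient steps of size at most `2 / L` do not move away from a minimizer. -/
theorem norm_gradient_step_sub_le {E : Type*} [NormedAddCommGroup E] [InnerProductSpace ℝ E]
    [CompleteSpace E] {f : E → ℝ} {g : E → E} {L : ℝ} (hL : 0 < L)
    (hf : ConvexOn ℝ Set.univ f) (h : ∀ x, HasGradientAt f (g x) x)
    (hlip : ∀ x y, ‖g x - g y‖ ≤ L * ‖x - y‖) {z : E} (hz : ∀ x, f z ≤ f x)
    {η : ℝ} (hη : 0 ≤ η) (hstep : 0 ≤ 1 - L * η / 2) (x : E) :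
    ‖x - η • g x - z‖ ≤ ‖x - z‖ := by
  refine le_of_sq_le_sq ?_ (norm_nonneg _)
  have hco := norm_sq_gradient_le_mul_inner hL hf h hlip hz x
  have hinner : 0 ≤ inner ℝ (g x) (x - z) :=
    nonneg_of_mul_nonneg_right ((sq_nonneg _).trans hco) hL
  rw [sub_right_comm, norm_sub_sq_real, real_inner_smul_right, real_inner_comm, norm_smul,
    mul_pow, Real.norm_eq_abs, sq_abs]
  have h1 := mul_le_mul_of_nonneg_left hco (sq_nonneg η)
  have h2 := mul_nonneg (mul_nonneg hη hstep) hinner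
  linarith

/-- A sequence decreasing at a quadratic rate decays like `1 / t`. -/
theorem mul_le_of_quadratic_decrease {a R : ℝ} {δ : ℕ → ℝ} (hR : 0 < R)
    (hδ : ∀ t, 0 ≤ δ t) (ha : 0 ≤ a)
    (hrec : ∀ t, R * δ (t + 1) ≤ R * δ t - a * δ t ^ 2) (t : ℕ) : t * (a * δ t) ≤ R := by
  induction t with
  | zero => simpa using hR.le
  | succ t ih =>
    push_cast
    refine le_of_mul_le_mul_left ?_ hR
    set y := a * δ t
    have hy : 0 ≤ y := mul_nonneg ha (hδ t)
    have hnext : R * (a * δ (t + 1)) ≤ R * y - y ^ 2 := by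
      have := mul_le_mul_of_nonneg_left (hrec t) ha
      linear_combination this
    have ht : (0 : ℝ) ≤ t := t.cast_nonneg
    have hbound : (t + 1) * (R * y - y ^ 2) ≤ R * R := by
      rcases le_total y R with hle | hle
      · nlinarith [mul_le_mul_of_nonneg_right ih (sub_nonneg.2 hle), sq_nonneg y]
      · nlinarith [mul_nonneg (add_nonneg ht zero_le_one) (mul_nonneg hy (sub_nonneg.2 hle)),
          mul_pos hR hR]
    have := mul_le_mul_of_nonneg_left hnext (add_nonneg ht zero_le_one)
    linarith

/-- Gradient descent on a convex `L`-smooth function converges at rate `1 / t`. -/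
theorem gradient_descent_sub_le {E : Type*} [NormedAddCommGroup E] [InnerProductSpace ℝ E]
    [CompleteSpace E] {f : E → ℝ} {g : E → E} {L : ℝ} (hL : 0 < L)
    (hf : ConvexOn ℝ Set.univ f) (h : ∀ x, HasGradientAt f (g x) x)
    (hlip : ∀ x y, ‖g x - g y‖ ≤ L * ‖x - y‖) {z : E} (hz : ∀ x, f z ≤ f x)
    {η : ℝ} (hη : 0 < η) (hstep : 0 < 1 - L * η / 2)
    {w : ℕ → E} (hw : ∀ t, w (t + 1) = w t - η • g (w t)) {t : ℕ} (ht : 1 ≤ t) :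
    f (w t) - f z ≤ ‖w 0 - z‖ ^ 2 * (1 / (η * (1 - L * η / 2))) * (1 / (t : ℝ)) := by
  have hdist (n : ℕ) : ‖w n - z‖ ≤ ‖w 0 - z‖ := by
    induction n with
    | zero => rfl
    | succ n ih =>
      rw [hw]
      exact (norm_gradient_step_sub_le hL hf h hlip hz hη.le hstep.le (w n)).trans ih
  have ha : 0 < η * (1 - L * η / 2) := mul_pos hη hstep
  have ht' : (0 : ℝ) < t := by exact_mod_cast ht
  rcases (norm_nonneg (w 0 - z)).eq_or_lt with h0 | h0
  · have hwt : w t = z := sub_eq_zero.1 (norm_le_zero_iff.1 (h0 ▸ hdist t))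
    rw [hwt, sub_self]
    positivity
  have hgap (n : ℕ) : (f (w n) - f z) ^ 2 ≤ ‖w 0 - z‖ ^ 2 * ‖g (w n)‖ ^ 2 := by
    rw [← mul_pow]
    refine pow_le_pow_left₀ (sub_nonneg.2 (hz _)) ?_ 2
    have htangent := hf.add_inner_gradient_le (h (w n)) z
    rw [← neg_sub (w n) z, inner_neg_right] at htangent
    have hcs := real_inner_le_norm (g (w n)) (w n - z)
    have := mul_le_mul_of_nonneg_left (hdist n) (norm_nonneg (g (w n)))
    linarith
  have hmain := mul_le_of_quadratic_decrease (δ := fun n => f (w n) - f z) (pow_pos h0 2)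
    (fun n => sub_nonneg.2 (hz _)) ha.le (fun n => by
      have hdec := gradient_step_le h hlip η (w n)
      rw [← hw] at hdec
      have h1 := mul_le_mul_of_nonneg_left hdec (sq_nonneg ‖w 0 - z‖)
      have h2 := mul_le_mul_of_nonneg_left (hgap n) ha.le
      linarith) t
  rw [mul_one_div, mul_one_div, le_div_iff₀ ht', le_div_iff₀ ha]
  linarith

/-- If the gradient of `f₂` is `c` times that of `f₁`, then `f₂` is `c • f₁` up to a constant. -/
theorem eq_smul_add_const_of_hasGradientAt {E : Type*} [NormedAddCommGroup E]
    [InnerProductSpace ℝ E] [CompleteSpace E] {f₁ f₂ : E → ℝ} {g : E → E} {c : ℝ}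
    (h₁ : ∀ x, HasGradientAt f₁ (g x) x) (h₂ : ∀ x, HasGradientAt f₂ (c • g x) x) :
    ∃ d, f₂ = fun x => c • f₁ x + d := by
  have hderiv (x : E) : HasFDerivAt (fun y => f₂ y - c • f₁ y) (0 : E →L[ℝ] ℝ) x := by
    refine ((h₂ x).hasFDerivAt.sub ((h₁ x).hasFDerivAt.const_smul c)).congr_fderiv ?_
    simp
  refine ⟨f₂ 0 - c • f₁ 0, funext fun x => ?_⟩
  have := is_const_of_fderiv_eq_zero (fun x => (hderiv x).differentiableAt)
    (fun x => (hderiv x).fderiv) x 0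
  linarith

/-- Proposition 2: convergence of the robust design under the expectation-based model,
where the regularized loss Fᵉ has gradient (1 + σₑ²) ∇F. -/
theorem stmt_3 {E : Type*} [NormedAddCommGroup E] [InnerProductSpace ℝ E] [CompleteSpace E]
    (F Fe : E → ℝ) (F' : E → E) (β σe : ℝ) (hβ : 0 < β) (hσ : 0 ≤ σe)
    (hconv : ConvexOn ℝ Set.univ F)
    (hgrad : ∀ x, HasGradientAt F (F' x) x)
    (hlip : ∀ x y, ‖F' x - F' y‖ ≤ β * ‖x - y‖)
    (hgradE : ∀ x, HasGradientAt Fe ((1 + σe) • F' x) x)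
    (wstar : E) (hmin : ∀ x, F wstar ≤ F x)
    (η : ℝ) (hη : 0 < η) (hstep : 0 < 1 - (1 + σe) * β * η / 2)
    (w : ℕ → E) (hiter : ∀ t, w (t + 1) = w t - η • ((1 + σe) • F' (w t))) :
    (∀ x, Fe wstar ≤ Fe x) ∧
    ∀ t : ℕ, 1 ≤ t → Fe (w t) - Fe wstar ≤
      ‖w 0 - wstar‖ ^ 2 * (1 / (η * (1 - (1 + σe) * β * η / 2))) * (1 / (t : ℝ)) := by
  have hc : 0 < 1 + σe := by linarith
  obtain ⟨d, hd⟩ := eq_smul_add_const_of_hasGradientAt hgrad hgradE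
  have hconvE : ConvexOn ℝ Set.univ Fe := hd ▸ (hconv.smul hc.le).add_const d
  have hminE (x : E) : Fe wstar ≤ Fe x := by
    simp only [hd, smul_eq_mul]
    gcongr
    exact hmin x
  refine ⟨hminE, fun t ht => ?_⟩
  refine gradient_descent_sub_le (mul_pos hc hβ) hconvE hgradE (fun x y => ?_) hminE hη hstep
    hiter ht
  rw [← smul_sub, norm_smul, Real.norm_of_nonneg hc.le, mul_assoc]
  gcongr
  exact hlip x y
end

section
/- Let E be a real Hilbert space and let f : E → ℝ be convex and differentiable everywhere with β-Lipschitz gradient for some β > 0. Then for all x, y ∈ E, ⟨∇f(x) − ∇f(y), x − y⟩ ≥ (1/β) ‖∇f(x) − ∇f(y)‖² (co-coercivity of the gradient). -/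
open RealInnerProductSpace

section SmoothConvex

variable {E : Type*} [NormedAddCommGroup E] [InnerProductSpace ℝ E] [CompleteSpace E]
  {f : E → ℝ} {f' : E → E} {β : ℝ}

theorem HasGradientAt.hasDerivAt_comp_add_smul {g x v : E} {t : ℝ}
    (h : HasGradientAt f g (x + t • v)) :
    HasDerivAt (fun s : ℝ => f (x + s • v)) ⟪g, v⟫ t := by
  have hline : HasDerivAt (fun s : ℝ => x + s • v) v t := by
    simpa using ((hasDerivAt_id t).smul_const v).const_add x
  simpa [Function.comp_def] using h.hasFDerivAt.comp_hasDerivAt t hline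

/-- A convex function lies above its tangent hyperplanes. -/
theorem ConvexOn.add_inner_gradient_le_s12 (hconv : ConvexOn ℝ Set.univ f) {g x : E}
    (hg : HasGradientAt f g x) (v : E) : f x + ⟪g, v⟫ ≤ f (x + v) := by
  have hline : ConvexOn ℝ Set.univ (fun t : ℝ => f (x + t • v)) := by
    have h := hconv.comp_affineMap (AffineMap.lineMap x (x + v) : ℝ →ᵃ[ℝ] E)
    simpa [Function.comp_def, AffineMap.lineMap_apply, add_comm] using h
  have hderiv : HasDerivAt (fun t : ℝ => f (x + t • v)) ⟪g, v⟫ 0 :=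
    HasGradientAt.hasDerivAt_comp_add_smul (by simpa using hg)
  have h := hline.le_slope_of_hasDerivAt (Set.mem_univ 0) (Set.mem_univ 1) zero_lt_one hderiv
  simp only [slope_def_field, one_smul, zero_smul, add_zero, sub_zero, div_one] at h
  linarith

/-- The descent lemma: a function with `β`-Lipschitz gradient has a quadratic upper bound. -/
theorem le_add_inner_gradient_add_sq_s12 (hgrad : ∀ x, HasGradientAt f (f' x) x)
    (hlip : ∀ x y, ‖f' x - f' y‖ ≤ β * ‖x - y‖) (x v : E) :
    f (x + v) ≤ f x + ⟪f' x, v⟫ + β / 2 * ‖v‖ ^ 2 := by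
  have hderiv (t : ℝ) : HasDerivAt (fun s : ℝ => f (x + s • v)) ⟪f' (x + t • v), v⟫ t :=
    (hgrad _).hasDerivAt_comp_add_smul
  have hbound (t : ℝ) :
      HasDerivAt (fun s : ℝ => f x + s * ⟪f' x, v⟫ + β / 2 * ‖v‖ ^ 2 * s ^ 2)
        (⟪f' x, v⟫ + β * ‖v‖ ^ 2 * t) t := by
    refine ((((hasDerivAt_id t).mul_const ⟪f' x, v⟫).const_add (f x)).add
      ((hasDerivAt_pow 2 t).const_mul (β / 2 * ‖v‖ ^ 2))).congr_deriv ?_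
    norm_num
    ring
  have hle (t : ℝ) (ht : 0 ≤ t) :
      ⟪f' (x + t • v), v⟫ ≤ ⟪f' x, v⟫ + β * ‖v‖ ^ 2 * t := by
    have h := hlip (x + t • v) x
    rw [add_sub_cancel_left, norm_smul, Real.norm_of_nonneg ht] at h
    have hinner := real_inner_le_norm (f' (x + t • v) - f' x) v
    rw [inner_sub_left] at hinner
    nlinarith [mul_le_mul_of_nonneg_right h (norm_nonneg v)]
  have h := image_le_of_deriv_right_le_deriv_boundary (a := 0) (b := 1)
    (fun t _ => (hderiv t).continuousAt.continuousWithinAt)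
    (fun t _ => (hderiv t).hasDerivWithinAt) (by simp)
    (fun t _ => (hbound t).continuousAt.continuousWithinAt)
    (fun t _ => (hbound t).hasDerivWithinAt) (fun t ht => hle t ht.1)
    (Set.right_mem_Icc.mpr zero_le_one)
  simpa using h

/-- The tangent bound of a convex `β`-smooth function improves by a multiple of the squared
distance between the gradients. -/
theorem ConvexOn.add_inner_gradient_add_sq_le (hβ : 0 < β) (hconv : ConvexOn ℝ Set.univ f)
    (hgrad : ∀ x, HasGradientAt f (f' x) x)
    (hlip : ∀ x y, ‖f' x - f' y‖ ≤ β * ‖x - y‖) (x y : E) :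
    f x + ⟪f' x, y - x⟫ + 1 / (2 * β) * ‖f' x - f' y‖ ^ 2 ≤ f y := by
  set d := f' x - f' y with hd
  have hlower := hconv.add_inner_gradient_le_s12 (hgrad x) (y - x + (1 / β) • d)
  have hupper := le_add_inner_gradient_add_sq_s12 hgrad hlip y ((1 / β) • d)
  rw [show x + (y - x + (1 / β) • d) = y + (1 / β) • d by abel, inner_add_right,
    real_inner_smul_right] at hlower
  rw [real_inner_smul_right, norm_smul, Real.norm_of_nonneg (by positivity)] at hupper
  have hinner : ⟪f' x, d⟫ - ⟪f' y, d⟫ = ‖d‖ ^ 2 := by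
    rw [← inner_sub_left, ← hd, real_inner_self_eq_norm_sq]
  have hscale : β / 2 * (1 / β * ‖d‖) ^ 2 = 1 / (2 * β) * ‖d‖ ^ 2 := by
    field_simp
  have hgap : 1 / β * ⟪f' x, d⟫ - 1 / β * ⟪f' y, d⟫ = 2 * (1 / (2 * β) * ‖d‖ ^ 2) := by
    rw [← mul_sub, hinner]
    field_simp
  linarith

end SmoothConvex

/-- Co-coercivity (Baillon–Haddad) of the gradient of a convex β-smooth function. -/
theorem stmt_12 {E : Type*} [NormedAddCommGroup E] [InnerProductSpace ℝ E] [CompleteSpace E]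
    (f : E → ℝ) (f' : E → E) (β : ℝ) (hβ : 0 < β)
    (hconv : ConvexOn ℝ Set.univ f)
    (hgrad : ∀ x, HasGradientAt f (f' x) x)
    (hlip : ∀ x y, ‖f' x - f' y‖ ≤ β * ‖x - y‖) :
    ∀ x y, ⟪f' x - f' y, x - y⟫ ≥ (1 / β) * ‖f' x - f' y‖ ^ 2 := by
  intro x y
  have hxy := hconv.add_inner_gradient_add_sq_le hβ hgrad hlip x y
  have hyx := hconv.add_inner_gradient_add_sq_le hβ hgrad hlip y x
  rw [norm_sub_rev] at hyx
  rw [← neg_sub x y, inner_neg_right] at hxy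
  have hsum : 1 / β * ‖f' x - f' y‖ ^ 2 = 2 * (1 / (2 * β) * ‖f' x - f' y‖ ^ 2) := by
    field_simp
  rw [inner_sub_left, hsum]
  linarith
end
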